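/- Let x be a diagonally envy-free utility matrix with u*_f(x) > 0 whose ratio attains the price of envy-freeness, u*(x)/u*_f(x) = p_envy(n,n), and let τ : {1,...,n} → {1,...,n} be an optimal assignment of items to agents, i.e., ∑_{i=1}^n x(i,τ(i)) = u*(x). If agent j is small (j is not in the image of τ), then x(i,j) = 1/n for all items i. -/

import Mathlib

open Finset

/-- A utility matrix for `n` agents and `n` items: `x i j` is the (nonnegative)
utility of agent `j` for item `i`, and each agent's utilities sum to `1`. -/
def IsUtilMatrix (n : ℕ) (x : Fin n → Fin n → ℝ) : Prop :=
  (∀ i j, 0 ≤ x i j) ∧ (∀ j, ∑ i, x i j = 1)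

/-- `x` is diagonally envy-free: the allocation assigning item `j` to agent `j`
is envy-free, i.e. `x j j ≥ x i j` for all `i, j`. -/
def DiagEnvyFree (n : ℕ) (x : Fin n → Fin n → ℝ) : Prop :=
  ∀ i j, x j j ≥ x i j

/-- Optimal welfare: each item goes to an agent valuing it the most. -/
noncomputable def uStar (n : ℕ) (x : Fin n → Fin n → ℝ) : ℝ :=
  ∑ i, ⨆ j, x i j

/-- Welfare of the (envy-free) diagonal allocation. -/
noncomputable def uStarF (n : ℕ) (x : Fin n → Fin n → ℝ) : ℝ :=
  ∑ j, x j j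

/-- The price of envy-freeness for `n` agents and `n` items: the supremum of
`uStar x / uStarF x` over all diagonally envy-free utility matrices `x`. -/
noncomputable def pEnvySq (n : ℕ) : ℝ :=
  sSup {r : ℝ | ∃ x : Fin n → Fin n → ℝ,
    IsUtilMatrix n x ∧ DiagEnvyFree n x ∧ r = uStar n x / uStarF n x}

/-- In a diagonally envy-free utility matrix, every agent gets a proportional share. -/
theorem one_div_le_diag {n : ℕ} {x : Fin n → Fin n → ℝ} (hx : IsUtilMatrix n x)
    (hef : DiagEnvyFree n x) (j : Fin n) : 1 / (n : ℝ) ≤ x j j := by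
  have hn : (0 : ℝ) < n := by exact_mod_cast j.pos
  have h : ∑ i, x i j ≤ ∑ _i : Fin n, x j j := sum_le_sum fun i _ => hef i j
  rw [hx.2 j, sum_const, card_univ, Fintype.card_fin, nsmul_eq_mul] at h
  rwa [div_le_iff₀' hn]

theorem one_le_uStarF {n : ℕ} (hn : 1 ≤ n) {x : Fin n → Fin n → ℝ}
    (hx : IsUtilMatrix n x) (hef : DiagEnvyFree n x) : 1 ≤ uStarF n x := by
  have hn0 : (n : ℝ) ≠ 0 := by exact_mod_cast (by omega : n ≠ 0)
  have h : ∑ _j : Fin n, 1 / (n : ℝ) ≤ ∑ j, x j j :=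
    sum_le_sum fun j _ => one_div_le_diag hx hef j
  rwa [sum_const, card_univ, Fintype.card_fin, nsmul_eq_mul, mul_one_div_cancel hn0] at h

theorem sum_assignment_le_uStar {n : ℕ} (x : Fin n → Fin n → ℝ) (τ : Fin n → Fin n) :
    ∑ i, x i (τ i) ≤ uStar n x :=
  sum_le_sum fun i _ => le_ciSup (Set.finite_range (x i)).bddAbove (τ i)

theorem uStar_le {n : ℕ} {x : Fin n → Fin n → ℝ} (hx : IsUtilMatrix n x) :
    uStar n x ≤ n := by
  have h : uStar n x ≤ ∑ _i : Fin n, (1 : ℝ) := by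
    refine sum_le_sum fun i _ => ?_
    have : Nonempty (Fin n) := ⟨i⟩
    refine ciSup_le fun j => ?_
    rw [← hx.2 j]
    exact single_le_sum (f := fun i => x i j) (fun k _ => hx.1 k j) (mem_univ i)
  simpa using h

theorem div_le_pEnvySq {n : ℕ} (hn : 1 ≤ n) {x : Fin n → Fin n → ℝ}
    (hx : IsUtilMatrix n x) (hef : DiagEnvyFree n x) :
    uStar n x / uStarF n x ≤ pEnvySq n := by
  refine le_csSup ⟨n, ?_⟩ ⟨x, hx, hef, rfl⟩
  rintro r ⟨y, hy, hyef, rfl⟩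
  have h1 := one_le_uStarF hn hy hyef
  rw [div_le_iff₀ (by linarith)]
  nlinarith [uStar_le hy, (n.cast_nonneg : (0 : ℝ) ≤ n)]

/-- Let `x` be a diagonally envy-free utility matrix with `uStarF x > 0` whose
ratio attains `p_envy(n,n)`, and let `τ` be an optimal assignment of items to
agents. If agent `j` is small, i.e. not in the image of `τ`, then
`x i j = 1/n` for all items `i`. -/
theorem small_agent_uniform (n : ℕ) (hn : 1 ≤ n)
    (x : Fin n → Fin n → ℝ) (hx : IsUtilMatrix n x) (hef : DiagEnvyFree n x)
    (hpos : 0 < uStarF n x)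
    (hopt : uStar n x / uStarF n x = pEnvySq n)
    (τ : Fin n → Fin n) (hτ : ∑ i, x i (τ i) = uStar n x)
    (j : Fin n) (hsmall : j ∉ Set.range τ) :
    ∀ i : Fin n, x i j = 1 / n := by
  have hn0 : (n : ℝ) ≠ 0 := by exact_mod_cast (by omega : n ≠ 0)
  let y : Fin n → Fin n → ℝ := fun i k => if k = j then 1 / n else x i k
  have hy : IsUtilMatrix n y := by
    refine ⟨fun i k => ?_, fun k => ?_⟩ <;> by_cases hk : k = j
    · simp [y, hk]
    · simpa [y, hk] using hx.1 i k
    · simp [y, hk, hn0]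
    · simpa [y, hk] using hx.2 k
  have hyef : DiagEnvyFree n y := by
    intro i k
    by_cases hk : k = j
    · simp [y, hk]
    · simpa [y, hk] using hef i k
  have hnum : uStar n x ≤ uStar n y := by
    rw [← hτ]
    refine le_of_eq_of_le (sum_congr rfl fun i _ => ?_) (sum_assignment_le_uStar y τ)
    have hne : τ i ≠ j := fun h => hsmall ⟨i, h⟩
    simp [y, hne]
  have hden : uStarF n x - uStarF n y = x j j - 1 / n := by
    unfold uStarF
    rw [← sum_sub_distrib, sum_eq_single j]
    · simp [y]
    · intro k _ hk
      simp [y, hk]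
    · simp
  have hyF := one_le_uStarF hn hy hyef
  have hxpos : 0 < uStar n x := hpos.trans_le (sum_assignment_le_uStar x id)
  have hratio := div_le_pEnvySq hn hy hyef
  rw [← hopt, div_le_div_iff₀ (by linarith) hpos] at hratio
  have hdiag : x j j ≤ 1 / n := by
    have h := (mul_le_mul_of_nonneg_right hnum hpos.le).trans hratio
    linarith [le_of_mul_le_mul_left h hxpos]
  have hle : ∀ i ∈ univ, x i j ≤ 1 / (n : ℝ) := fun i _ => (hef i j).trans hdiag
  have hsum : ∑ i, x i j = ∑ _i : Fin n, 1 / (n : ℝ) := by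
    rw [hx.2 j]
    simp [hn0]
  exact fun i => (sum_eq_sum_iff_of_le hle).1 hsum i (mem_univ i)
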